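/- arXiv:1612.06447 — 3 statements merged into one kernel-verified Lean document; each statement's English description precedes it below -/
import Mathlib

section
/- Let $(X,d)$ be a metric space, let $\mu$ be a Borel measure on $X$ with $0 < \mu(B(x,r)) < \infty$ for every open ball $B(x,r)$, let $E \subset X$ be a $\mu$-measurable set, let $\delta > 0$, and let $c \ge 0$. Then the set $\{ x \in X : \mu(B(x,r) \setminus E) \le c\, \mu(B(x,r)) \text{ for all } 0 < r < \delta \}$ is a closed subset of $X$. -/
open MeasureTheory Metric

/-- The measure of `ball x r \ E` is bounded by any bound valid for all smaller positive radii. -/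
theorem measure_ball_diff_le_of_forall_lt {X : Type*} [PseudoMetricSpace X] [MeasurableSpace X]
    {μ : Measure X} {E : Set X} {x : X} {r : ℝ} {M : ENNReal} (hr : 0 < r)
    (h : ∀ t, 0 < t → t < r → μ (ball x t \ E) ≤ M) : μ (ball x r \ E) ≤ M := by
  obtain ⟨u, hu, hur, hlim⟩ := exists_seq_strictMono_tendsto' hr
  have hsub : ball x r \ E ⊆ ⋃ n, ball x (u n) \ E := by
    rintro y ⟨hy, hyE⟩
    obtain ⟨n, hn⟩ := (hlim.eventually (lt_mem_nhds (mem_ball.1 hy))).exists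
    exact Set.mem_iUnion.2 ⟨n, hn, hyE⟩
  have hmono : Monotone fun n => ball x (u n) \ E := fun m n hmn =>
    Set.sdiff_subset_sdiff_left (ball_subset_ball (hu.monotone hmn))
  refine (measure_mono hsub).trans ?_
  rw [hmono.measure_iUnion]
  exact iSup_le fun n => h _ (hur n).1 (hur n).2

/-- If `μ` is a Borel measure positive and finite on balls, `E` is `μ`-measurable,
`δ > 0` and `c ≥ 0`, then the set of points `x` such that
`μ(B(x,r) \ E) ≤ c μ(B(x,r))` for all `0 < r < δ` is closed. -/
theorem interior_density_set_closed
    {X : Type*} [MetricSpace X] [MeasurableSpace X] [BorelSpace X]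
    (μ : Measure X)
    (hpos : ∀ (x : X) (r : ℝ), 0 < r → 0 < μ (ball x r))
    (hfin : ∀ (x : X) (r : ℝ), 0 < r → μ (ball x r) < ⊤)
    (E : Set X) (hE : MeasurableSet E) (δ : ℝ) (hδ : 0 < δ) (c : ℝ) (hc : 0 ≤ c) :
    IsClosed {x : X | ∀ r : ℝ, 0 < r → r < δ →
      μ (ball x r \ E) ≤ ENNReal.ofReal c * μ (ball x r)} := by
  refine isClosed_of_closure_subset fun x hx r hr hrδ => ?_
  refine measure_ball_diff_le_of_forall_lt hr fun t ht htr => ?_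
  obtain ⟨y, hy, hxy⟩ := Metric.mem_closure_iff.1 hx ((r - t) / 2) (by linarith)
  have hty : ball x t ⊆ ball y ((t + r) / 2) := ball_subset_ball' (by linarith)
  have hyr : ball y ((t + r) / 2) ⊆ ball x r :=
    ball_subset_ball' (by rw [dist_comm]; linarith)
  calc μ (ball x t \ E) ≤ μ (ball y ((t + r) / 2) \ E) :=
        measure_mono (Set.sdiff_subset_sdiff_left hty)
    _ ≤ ENNReal.ofReal c * μ (ball y ((t + r) / 2)) := hy _ (by linarith) (by linarith)
    _ ≤ ENNReal.ofReal c * μ (ball x r) := by gcongr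
end

section
/- Let $(X,d)$ be a metric space and let $\mu$ be a Borel measure on $X$ that is doubling with constant $C_d \ge 1$, i.e. $0 < \mu(B(x,2r)) \le C_d\,\mu(B(x,r)) < \infty$ for all balls. Let $F \subset X$ be $\mu$-measurable, let $x \in X$, $s > 0$, and $N \in \mathbb{N}$ be such that $\mu(B(x,s) \cap F) > \mu(B(x,s))/(2C_d)$ and $\mu(B(x,2^N s) \cap F) \le \mu(B(x,2^N s))/(2C_d)$. Then there exists an integer $k$ with $0 \le k < N$ such that the radius $r = 2^k s$ satisfies $1/(2C_d) < \mu(B(x,r) \cap F)/\mu(B(x,r)) \le 1/2$. -/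
open MeasureTheory Metric

/-- Doubling of radii: if the relative density of `F` in `B(x,s)` exceeds `1/(2C_d)`
but the relative density in `B(x, 2^N s)` is at most `1/(2C_d)`, then there is some
`0 ≤ k < N` such that for `r = 2^k s` the relative density of `F` in `B(x,r)` lies in
`(1/(2C_d), 1/2]`. -/
theorem doubling_radius_selection
    {X : Type*} [MetricSpace X] [MeasurableSpace X] [BorelSpace X]
    (μ : Measure X) (C_d : ℝ) (hC : 1 ≤ C_d)
    (hpos : ∀ (x : X) (r : ℝ), 0 < r → 0 < μ (ball x r))
    (hfin : ∀ (x : X) (r : ℝ), 0 < r → μ (ball x r) < ⊤)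
    (hdoub : ∀ (x : X) (r : ℝ), 0 < r →
      μ (ball x (2 * r)) ≤ ENNReal.ofReal C_d * μ (ball x r))
    (F : Set X) (hF : MeasurableSet F) (x : X) (s : ℝ) (hs : 0 < s) (N : ℕ)
    (h1 : (μ (ball x s)).toReal / (2 * C_d) < (μ (ball x s ∩ F)).toReal)
    (h2 : (μ (ball x (2 ^ N * s) ∩ F)).toReal
          ≤ (μ (ball x (2 ^ N * s))).toReal / (2 * C_d)) :
    ∃ k : ℕ, k < N ∧
      1 / (2 * C_d)
        < (μ (ball x (2 ^ k * s) ∩ F)).toReal / (μ (ball x (2 ^ k * s))).toReal ∧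
      (μ (ball x (2 ^ k * s) ∩ F)).toReal / (μ (ball x (2 ^ k * s))).toReal
        ≤ 1 / 2 := by
  classical
  have hC0 : 0 < C_d := by linarith
  have hex : ∃ n : ℕ, (μ (ball x (2 ^ n * s) ∩ F)).toReal
      ≤ (μ (ball x (2 ^ n * s))).toReal / (2 * C_d) := ⟨N, h2⟩
  obtain ⟨k, hk⟩ : ∃ k, Nat.find hex = k + 1 := by
    refine Nat.exists_eq_succ_of_ne_zero fun h0 => ?_
    have h := Nat.find_spec hex
    rw [h0, pow_zero, one_mul] at h
    linarith
  have hkN : k < N := by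
    have := Nat.find_min' hex h2
    omega
  have hlow := Nat.find_min hex (m := k) (by omega)
  have hup := Nat.find_spec hex
  rw [hk, pow_succ', mul_assoc] at hup
  rw [not_le] at hlow
  have hr : 0 < 2 ^ k * s := by positivity
  have hr2 : 0 < 2 * (2 ^ k * s) := by positivity
  have hm : 0 < (μ (ball x (2 ^ k * s))).toReal :=
    ENNReal.toReal_pos (hpos x _ hr).ne' (hfin x _ hr).ne
  have hmono : (μ (ball x (2 ^ k * s) ∩ F)).toReal
      ≤ (μ (ball x (2 * (2 ^ k * s)) ∩ F)).toReal := by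
    refine ENNReal.toReal_mono
      (measure_lt_top_mono Set.inter_subset_left (hfin x _ hr2)).ne (measure_mono ?_)
    exact Set.inter_subset_inter_left F (ball_subset_ball (by linarith))
  have hd : (μ (ball x (2 * (2 ^ k * s)))).toReal
      ≤ C_d * (μ (ball x (2 ^ k * s))).toReal := by
    have h := ENNReal.toReal_mono
      (ENNReal.mul_ne_top ENNReal.ofReal_ne_top (hfin x _ hr).ne) (hdoub x _ hr)
    rwa [ENNReal.toReal_mul, ENNReal.toReal_ofReal hC0.le] at h
  refine ⟨k, hkN, ?_, ?_⟩
  · rw [lt_div_iff₀ hm, one_div_mul_eq_div]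
    exact hlow
  · rw [div_le_iff₀ hm]
    refine hmono.trans (hup.trans ?_)
    rw [div_le_iff₀ (by positivity)]
    linarith
end

section
/- Let $(X,d)$ be a metric space and let $\mu$ be a Borel measure on $X$ that is doubling with constant $C_d \ge 1$, i.e. $0 < \mu(B(x,2r)) \le C_d\,\mu(B(x,r)) < \infty$ for all balls. Let $E \subset X$ be $\mu$-measurable and let $x \in X$ be a point with $\lim_{r \to 0} \mu(B(x,r) \setminus E)/\mu(B(x,r)) = 0$. Let $j \ge 2$ be a real number and suppose $s > 0$ satisfies $\mu(B(x,s) \setminus E) > \mu(B(x,s))/j$. Then there exists $0 < r \le s$ such that $\mu(B(x,r) \setminus E) > \mu(B(x,r))/j$ and $\mu(B(x,r) \cap E) \ge \mu(B(x,r))/(2 C_d)$; in particular $\min\{\mu(B(x,r)\cap E),\, \mu(B(x,r)\setminus E)\} \ge \mu(B(x,r))/(2 C_d j)$. -/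
open MeasureTheory Metric Filter

/-- Halving of radii: if `x` is a point of density `1` of `E` for a doubling measure `μ`
and `μ(B(x,s) \ E) > μ(B(x,s))/j` for some `s > 0` and `j ≥ 2`, then there is
`0 < r ≤ s` with `μ(B(x,r) \ E) > μ(B(x,r))/j` and `μ(B(x,r) ∩ E) ≥ μ(B(x,r))/(2C_d)`;
in particular `min{μ(B(x,r) ∩ E), μ(B(x,r) \ E)} ≥ μ(B(x,r))/(2 C_d j)`. -/
theorem halving_radius_selection
    {X : Type*} [MetricSpace X] [MeasurableSpace X] [BorelSpace X]
    (μ : Measure X) (C_d : ℝ) (hC : 1 ≤ C_d)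
    (hpos : ∀ (x : X) (r : ℝ), 0 < r → 0 < μ (ball x r))
    (hfin : ∀ (x : X) (r : ℝ), 0 < r → μ (ball x r) < ⊤)
    (hdoub : ∀ (x : X) (r : ℝ), 0 < r →
      μ (ball x (2 * r)) ≤ ENNReal.ofReal C_d * μ (ball x r))
    (E : Set X) (hE : MeasurableSet E) (x : X)
    (hdens : Tendsto (fun r : ℝ => (μ (ball x r \ E)).toReal / (μ (ball x r)).toReal)
      (nhdsWithin 0 (Set.Ioi 0)) (nhds 0))
    (j : ℝ) (hj : 2 ≤ j) (s : ℝ) (hs : 0 < s)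
    (hbig : (μ (ball x s)).toReal / j < (μ (ball x s \ E)).toReal) :
    ∃ r : ℝ, 0 < r ∧ r ≤ s ∧
      (μ (ball x r)).toReal / j < (μ (ball x r \ E)).toReal ∧
      (μ (ball x r)).toReal / (2 * C_d) ≤ (μ (ball x r ∩ E)).toReal ∧
      (μ (ball x r)).toReal / (2 * C_d * j)
        ≤ min (μ (ball x r ∩ E)).toReal (μ (ball x r \ E)).toReal := by
  have hj0 : 0 < j := by linarith
  have hC0 : 0 < C_d := by linarith
  have hmpos : ∀ r : ℝ, 0 < r → 0 < (μ (ball x r)).toReal := fun r hr =>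
    ENNReal.toReal_pos (hpos x r hr).ne' (hfin x r hr).ne
  have hrad : ∀ n : ℕ, 0 < s / 2 ^ n := fun n => by positivity
  have htend : Tendsto (fun n : ℕ => s / 2 ^ n) atTop (nhdsWithin 0 (Set.Ioi 0)) := by
    refine tendsto_nhdsWithin_iff.2 ⟨?_, Eventually.of_forall hrad⟩
    exact tendsto_const_nhds.div_atTop (tendsto_pow_atTop_atTop_of_one_lt one_lt_two)
  have hex : ∃ n : ℕ, (μ (ball x (s / 2 ^ n) \ E)).toReal ≤ (μ (ball x (s / 2 ^ n))).toReal / j := by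
    obtain ⟨n, hn⟩ := ((hdens.comp htend).eventually_lt_const (one_div_pos.2 hj0)).exists
    refine ⟨n, ?_⟩
    have h := (div_lt_iff₀ (hmpos _ (hrad n))).1 hn
    rw [one_div_mul_eq_div] at h
    exact h.le
  classical
  obtain ⟨n, hn, hmin⟩ : ∃ n : ℕ,
      (μ (ball x (s / 2 ^ (n + 1)) \ E)).toReal ≤ (μ (ball x (s / 2 ^ (n + 1)))).toReal / j ∧
      (μ (ball x (s / 2 ^ n))).toReal / j < (μ (ball x (s / 2 ^ n) \ E)).toReal := by
    have hspec := Nat.find_spec hex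
    rcases hk : Nat.find hex with _ | n
    · rw [hk, pow_zero, div_one] at hspec
      exact absurd hspec hbig.not_ge
    · exact ⟨n, hk ▸ hspec, not_le.1 (Nat.find_min hex (by omega))⟩
  set r := s / 2 ^ n with hr
  have hr0 : 0 < r := hrad n
  have hhalf : s / 2 ^ (n + 1) = r / 2 := by rw [hr, pow_succ, div_mul_eq_div_div]
  rw [hhalf] at hn
  have hr2 : 0 < r / 2 := half_pos hr0
  have hdouble : (μ (ball x r)).toReal ≤ C_d * (μ (ball x (r / 2))).toReal := by
    have h := hdoub x (r / 2) hr2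
    rw [mul_div_cancel₀ r two_ne_zero] at h
    have h' := ENNReal.toReal_mono (ENNReal.mul_ne_top ENNReal.ofReal_ne_top (hfin x _ hr2).ne) h
    rwa [ENNReal.toReal_mul, ENNReal.toReal_ofReal hC0.le] at h'
  have hsplit : (μ (ball x (r / 2) ∩ E)).toReal + (μ (ball x (r / 2) \ E)).toReal
      = (μ (ball x (r / 2))).toReal :=
    measureReal_inter_add_sdiff hE (hfin x _ hr2).ne
  have hmono : (μ (ball x (r / 2) ∩ E)).toReal ≤ (μ (ball x r ∩ E)).toReal :=
    ENNReal.toReal_mono (measure_ne_top_of_subset Set.inter_subset_left (hfin x r hr0).ne)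
      (measure_mono (Set.inter_subset_inter_left E (ball_subset_ball (by linarith))))
  have hhalfE : (μ (ball x (r / 2))).toReal / j ≤ (μ (ball x (r / 2))).toReal / 2 :=
    div_le_div_of_nonneg_left (hmpos _ hr2).le two_pos hj
  have hE' : (μ (ball x r)).toReal / (2 * C_d) ≤ (μ (ball x r ∩ E)).toReal := by
    rw [div_le_iff₀ (by positivity)]
    nlinarith
  have hm := (hmpos r hr0).le
  refine ⟨r, hr0, div_le_self hs.le (one_le_pow₀ one_le_two), hmin, hE', le_min ?_ ?_⟩
  · refine le_trans (div_le_div_of_nonneg_left hm (by positivity) ?_) hE'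
    exact le_mul_of_one_le_right (by positivity) (by linarith)
  · refine le_trans (div_le_div_of_nonneg_left hm hj0 ?_) hmin.le
    exact le_mul_of_one_le_left hj0.le (by linarith)
end
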